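/- The operator A : W → C(D) is Lipschitz continuous with respect to the sup norm: for all f, g ∈ W, ‖Af − Ag‖ ≤ ( 2 (U₂²/U₁²) √a + U₂² Δ₂(0)² / (U₁ ε²) ) ‖f − g‖. -/

import Mathlib

open Set MeasureTheory Filter Topology

noncomputable section

/-- The context of the BCS-Bogoliubov model: the cutoff `eps`, the Debye energy `om = ℏω_D`,
the potential `U` with bounds `U₁ ≤ U ≤ U₂`, the constant `a`, the temperatures
`tau₁, tau₂, T₀, Tc`, the solutions `Δ₁, Δ₂` of the constant-potential gap equations,
the constant `Mz = max_{z ≥ 0} z / cosh z` and the constant `MT = M_T`. -/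
structure BCSContext where
  eps : ℝ
  om : ℝ
  U : ℝ → ℝ → ℝ
  U₁ : ℝ
  U₂ : ℝ
  Umax : ℝ
  Umin : ℝ
  a : ℝ
  tau₁ : ℝ
  tau₂ : ℝ
  Δ₁ : ℝ → ℝ
  Δ₂ : ℝ → ℝ
  Tc : ℝ
  T₀ : ℝ
  Mz : ℝ
  MT : ℝ
  heps : 0 < eps
  hepsom : eps < om
  hU₁pos : 0 < U₁
  hU₁₂ : U₁ ≤ U₂
  hUsmooth : ContDiffOn ℝ 2 (fun p : ℝ × ℝ => U p.1 p.2) (Icc eps om ×ˢ Icc eps om)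
  hUlb : ∀ x ∈ Icc eps om, ∀ ξ ∈ Icc eps om, U₁ ≤ U x ξ
  hUub : ∀ x ∈ Icc eps om, ∀ ξ ∈ Icc eps om, U x ξ ≤ U₂
  hUmax : IsGreatest (Set.image2 U (Icc eps om) (Icc eps om)) Umax
  hUmin : IsLeast (Set.image2 U (Icc eps om) (Icc eps om)) Umin
  ha : a = (Umax / Umin) ^ 2
  htau₁pos : 0 < tau₁
  htau₂pos : 0 < tau₂
  htau₁ : 1 = U₁ * (∫ ξ in eps..om, Real.tanh (ξ / (2 * tau₁)) / ξ)
  htau₂ : 1 = U₂ * (∫ ξ in eps..om, Real.tanh (ξ / (2 * tau₂)) / ξ)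
  hΔ₁nonneg : ∀ T, 0 ≤ Δ₁ T
  hΔ₂nonneg : ∀ T, 0 ≤ Δ₂ T
  hΔ₁cont : Continuous Δ₁
  hΔ₂cont : Continuous Δ₂
  hΔ₁anti : StrictAntiOn Δ₁ (Icc 0 tau₁)
  hΔ₂anti : StrictAntiOn Δ₂ (Icc 0 tau₂)
  hΔ₁eq : ∀ T ∈ Ioc 0 tau₁, U₁ * (∫ ξ in eps..om,
      Real.tanh (Real.sqrt (ξ ^ 2 + Δ₁ T ^ 2) / (2 * T)) / Real.sqrt (ξ ^ 2 + Δ₁ T ^ 2)) = 1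
  hΔ₂eq : ∀ T ∈ Ioc 0 tau₂, U₂ * (∫ ξ in eps..om,
      Real.tanh (Real.sqrt (ξ ^ 2 + Δ₂ T ^ 2) / (2 * T)) / Real.sqrt (ξ ^ 2 + Δ₂ T ^ 2)) = 1
  hΔ₁zero : ∀ T, tau₁ ≤ T → Δ₁ T = 0
  hΔ₂zero : ∀ T, tau₂ ≤ T → Δ₂ T = 0
  hTc₁ : tau₁ ≤ Tc
  hTc₂ : Tc ≤ tau₂
  hT₀₁ : tau₁ < T₀
  hT₀₂ : T₀ < Tc
  hMz : IsGreatest ((fun z => z / Real.cosh z) '' Set.Ici (0 : ℝ)) Mz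
  hMT : MT = 4 * a * U₂ * Mz ^ 2 /
      (eps * U₁ *
        (Real.tanh (eps / (2 * Tc)) - (eps / (2 * Tc)) / Real.cosh (eps / (2 * Tc)) ^ 2) *
        (∫ ξ in eps..om, (ξ ^ 2 + Δ₂ 0 ^ 2) ^ (-(3 : ℝ) / 2)))

namespace BCSContext

/-- The energy interval `I = [ε, ℏω_D]`. -/
def Iset (C : BCSContext) : Set ℝ := Icc C.eps C.om

/-- The rectangle `D = [T₀, T_c] × I`. -/
def Dset (C : BCSContext) : Set (ℝ × ℝ) := Icc C.T₀ C.Tc ×ˢ Icc C.eps C.om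

end BCSContext

/-- The operator `A` of the squared BCS-Bogoliubov gap equation. -/
def opA (C : BCSContext) (f : ℝ → ℝ → ℝ) (T x : ℝ) : ℝ :=
  (∫ ξ in C.eps..C.om, C.U x ξ * Real.sqrt (f T ξ / (ξ ^ 2 + f T ξ)) *
      Real.tanh (Real.sqrt (ξ ^ 2 + f T ξ) / (2 * T))) ^ 2

/-- Partial derivative with respect to the temperature `T` (within `[T₀, T_c]`). -/
def pderivT (C : BCSContext) (g : ℝ → ℝ → ℝ) (T x : ℝ) : ℝ :=
  derivWithin (fun s => g s x) (Icc C.T₀ C.Tc) T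

/-- Partial derivative with respect to the energy `x` (within `I = [ε, ℏω_D]`). -/
def pderivX (C : BCSContext) (g : ℝ → ℝ → ℝ) (T x : ℝ) : ℝ :=
  derivWithin (fun y => g T y) (Icc C.eps C.om) x

/-- Membership in the set `W`. -/
def memW (C : BCSContext) (f : ℝ → ℝ → ℝ) : Prop :=
  ContDiffOn ℝ 2 (fun p : ℝ × ℝ => f p.1 p.2) C.Dset ∧
  (∀ T ∈ Icc C.T₀ C.Tc, ∀ x ∈ C.Iset, C.Δ₁ T ^ 2 ≤ f T x ∧ f T x ≤ C.Δ₂ T ^ 2) ∧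
  (∀ x ∈ C.Iset, f C.Tc x = 0) ∧
  (∀ T ∈ Ico C.T₀ C.Tc, ∀ x ∈ C.Iset, ∀ x₁ ∈ C.Iset, f T x ≤ C.a * f T x₁) ∧
  (∀ x ∈ C.Iset, ∀ x₁ ∈ C.Iset,
      -(pderivT C f C.Tc x) ≤ C.a * -(pderivT C f C.Tc x₁)) ∧
  (∀ T ∈ Icc C.T₀ C.Tc, ∀ x ∈ C.Iset, pderivT C f T x < 0) ∧
  (∀ T ∈ Icc C.T₀ C.Tc, ∀ x ∈ C.Iset, -(pderivT C f T x) ≤ C.MT)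

/-- The condition `a^{1/4} · max_{(T,x) ∈ D} ∫_I (U(x,ξ)/ξ) tanh(ξ/(2T)) dξ ≤ 1`. -/
def gapCondition (C : BCSContext) : Prop :=
  ∀ T ∈ Icc C.T₀ C.Tc, ∀ x ∈ C.Iset,
    C.a ^ ((1 : ℝ) / 4) * (∫ ξ in C.eps..C.om, C.U x ξ / ξ * Real.tanh (ξ / (2 * T))) ≤ 1

instance (C : BCSContext) : CompactSpace ↥C.Dset :=
  isCompact_iff_compactSpace.mp (isCompact_Icc.prod isCompact_Icc)

-- Extension of a continuous function on `D` to a function on `ℝ × ℝ` (by `0` outside `D`).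
open Classical in
def extFun (C : BCSContext) (F : C(↥C.Dset, ℝ)) : ℝ → ℝ → ℝ :=
  fun T x => if h : (T, x) ∈ C.Dset then F ⟨(T, x), h⟩ else 0

/-- The set `W` regarded as a subset of the Banach space `C(D)`. -/
def WSet (C : BCSContext) : Set C(↥C.Dset, ℝ) :=
  {F | ∃ f : ℝ → ℝ → ℝ, memW C f ∧ ∀ p : ↥C.Dset, F p = f (p : ℝ × ℝ).1 (p : ℝ × ℝ).2}

section HyperbolicTangent

lemma tanh_monotone : Monotone Real.tanh := by
  intro x y hxy
  rw [Real.tanh_eq_sinh_div_cosh, Real.tanh_eq_sinh_div_cosh,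
    div_le_div_iff₀ (Real.cosh_pos x) (Real.cosh_pos y)]
  have h : 0 ≤ Real.sinh (y - x) := Real.sinh_nonneg_iff.2 (sub_nonneg.2 hxy)
  rw [Real.sinh_sub] at h
  linarith

lemma tanh_nonneg_of_nonneg {x : ℝ} (hx : 0 ≤ x) : 0 ≤ Real.tanh x := by
  simpa using tanh_monotone hx

lemma continuous_tanh_real : Continuous Real.tanh := by
  rw [funext Real.tanh_eq_sinh_div_cosh]
  exact Real.continuous_sinh.div Real.continuous_cosh fun x => (Real.cosh_pos x).ne'

lemma convexOn_sinh : ConvexOn ℝ (Ici 0) Real.sinh := by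
  refine MonotoneOn.convexOn_of_deriv (convex_Ici 0) Real.continuous_sinh.continuousOn
    Real.differentiable_sinh.differentiableOn ?_
  rw [Real.deriv_sinh, interior_Ici]
  intro x hx y hy hxy
  rw [Real.cosh_le_cosh, abs_of_pos hx, abs_of_pos hy]
  exact hxy

lemma mul_sinh_le_mul_sinh {d s : ℝ} (hd : 0 ≤ d) (hds : d ≤ s) :
    s * Real.sinh d ≤ d * Real.sinh s := by
  rcases hd.eq_or_lt with rfl | hd'
  · simp
  have hs : 0 < s := hd'.trans_le hds
  have h := convexOn_sinh.2 (mem_Ici.2 hs.le) (mem_Ici.2 le_rfl) (div_nonneg hd hs.le)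
    (sub_nonneg.2 ((div_le_one hs).2 hds)) (by ring)
  simp only [smul_eq_mul, mul_zero, add_zero, Real.sinh_zero] at h
  rw [div_mul_cancel₀ _ hs.ne'] at h
  calc s * Real.sinh d ≤ s * (d / s * Real.sinh s) := by gcongr
    _ = d * Real.sinh s := by field_simp

lemma tanh_div_self_antitoneOn : AntitoneOn (fun x => Real.tanh x / x) (Ioi 0) := by
  intro x hx y hy hxy
  have hx : 0 < x := hx
  have hy : 0 < y := hy
  have h := mul_sinh_le_mul_sinh (sub_nonneg.2 hxy) (by linarith : y - x ≤ y + x)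
  rw [Real.sinh_sub, Real.sinh_add] at h
  simp only [Real.tanh_eq_sinh_div_cosh, div_div]
  rw [div_le_div_iff₀ (mul_pos (Real.cosh_pos y) hy) (mul_pos (Real.cosh_pos x) hx)]
  linarith

lemma tanh_div_two_mul_div_le {T y z : ℝ} (hT : 0 < T) (hy : 0 < y) (hyz : y ≤ z) :
    Real.tanh (z / (2 * T)) / z ≤ Real.tanh (y / (2 * T)) / y := by
  have hz := hy.trans_le hyz
  have h2T : 0 < 2 * T := by positivity
  have h := tanh_div_self_antitoneOn (mem_Ioi.2 (div_pos hy h2T)) (mem_Ioi.2 (div_pos hz h2T))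
    (by gcongr)
  dsimp only at h
  rw [div_div_eq_mul_div, div_div_eq_mul_div, mul_div_right_comm, mul_div_right_comm _ _ y] at h
  exact le_of_mul_le_mul_right h h2T

end HyperbolicTangent

/-- The integrand of the gap equation without the potential, as a function of the squared
gap `F`. -/
def gapKernel (T ξ F : ℝ) : ℝ :=
  Real.sqrt (F / (ξ ^ 2 + F)) * Real.tanh (Real.sqrt (ξ ^ 2 + F) / (2 * T))

lemma gapKernel_zero (T ξ : ℝ) : gapKernel T ξ 0 = 0 := by simp [gapKernel]

lemma gapKernel_mono {T ξ F G : ℝ} (hT : 0 < T) (hξ : 0 < ξ) (hG : 0 ≤ G) (hGF : G ≤ F) :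
    gapKernel T ξ G ≤ gapKernel T ξ F := by
  have hF := hG.trans hGF
  have hξ2 : 0 < ξ ^ 2 := by positivity
  have h1 : G / (ξ ^ 2 + G) ≤ F / (ξ ^ 2 + F) := by
    rw [div_le_div_iff₀ (by positivity) (by positivity)]
    nlinarith
  exact mul_le_mul (Real.sqrt_le_sqrt h1) (tanh_monotone (by gcongr))
    (tanh_nonneg_of_nonneg (by positivity)) (Real.sqrt_nonneg _)

lemma gapKernel_sub_le {T ξ F G : ℝ} (hT : 0 < T) (hξ : 0 < ξ) (hG : 0 ≤ G) (hGF : G ≤ F) :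
    gapKernel T ξ F - gapKernel T ξ G ≤
      (Real.sqrt F - Real.sqrt G) * (Real.tanh (ξ / (2 * T)) / ξ) := by
  have hF := hG.trans hGF
  have hk : ∀ H, 0 ≤ H → gapKernel T ξ H =
      Real.sqrt H * (Real.tanh (Real.sqrt (ξ ^ 2 + H) / (2 * T)) / Real.sqrt (ξ ^ 2 + H)) := by
    intro H hH
    rw [gapKernel, Real.sqrt_div hH]
    ring
  have hy : ξ ≤ Real.sqrt (ξ ^ 2 + G) := Real.le_sqrt_of_sq_le (by linarith)
  have hFG := tanh_div_two_mul_div_le hT (hξ.trans_le hy)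
    (Real.sqrt_le_sqrt (by linarith : ξ ^ 2 + G ≤ ξ ^ 2 + F))
  have hG0 := tanh_div_two_mul_div_le hT hξ hy
  rw [hk F hF, hk G hG]
  nlinarith [mul_le_mul_of_nonneg_left hFG (Real.sqrt_nonneg F),
    mul_le_mul_of_nonneg_left hG0 (sub_nonneg.2 (Real.sqrt_le_sqrt hGF))]

lemma gapKernel_nonneg {T : ℝ} (ξ F : ℝ) (hT : 0 < T) : 0 ≤ gapKernel T ξ F :=
  mul_nonneg (Real.sqrt_nonneg _) (tanh_nonneg_of_nonneg (by positivity))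

lemma gapKernel_le {T ξ F : ℝ} (hT : 0 < T) (hξ : 0 < ξ) (hF : 0 ≤ F) :
    gapKernel T ξ F ≤ Real.sqrt F * (Real.tanh (ξ / (2 * T)) / ξ) := by
  simpa [gapKernel_zero] using gapKernel_sub_le hT hξ le_rfl hF

lemma abs_gapKernel_sub_le {T ξ F G : ℝ} (hT : 0 < T) (hξ : 0 < ξ) (hF : 0 ≤ F) (hG : 0 ≤ G) :
    |gapKernel T ξ F - gapKernel T ξ G| ≤
      |Real.sqrt F - Real.sqrt G| * (Real.tanh (ξ / (2 * T)) / ξ) := by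
  rcases le_total G F with h | h
  · rw [abs_of_nonneg (sub_nonneg.2 (gapKernel_mono hT hξ hG h)),
      abs_of_nonneg (sub_nonneg.2 (Real.sqrt_le_sqrt h))]
    exact gapKernel_sub_le hT hξ hG h
  · rw [abs_sub_comm, abs_sub_comm (Real.sqrt F),
      abs_of_nonneg (sub_nonneg.2 (gapKernel_mono hT hξ hF h)),
      abs_of_nonneg (sub_nonneg.2 (Real.sqrt_le_sqrt h))]
    exact gapKernel_sub_le hT hξ hF h

lemma sqrt_add_sqrt_mul_abs_sqrt_sub_sqrt {F G : ℝ} (hF : 0 ≤ F) (hG : 0 ≤ G) :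
    (Real.sqrt F + Real.sqrt G) * |Real.sqrt F - Real.sqrt G| = |F - G| := by
  have h : 0 ≤ Real.sqrt F + Real.sqrt G := by positivity
  rw [← abs_of_nonneg h, ← abs_mul]
  congr 1
  nlinarith [Real.sq_sqrt hF, Real.sq_sqrt hG]

/-- If the values of `F` and of `G` vary at most by a factor `a`, then the squares of their
weighted gap integrals differ by at most a multiple of `sup |F - G|`. -/
lemma abs_sq_integral_gapKernel_sub_le {ε ω T a V N : ℝ} {u F G : ℝ → ℝ} (hε : 0 < ε)
    (hω : ε ≤ ω) (hT : 0 < T) (ha : 0 ≤ a)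
    (hu : ContinuousOn u (Icc ε ω)) (hF : ContinuousOn F (Icc ε ω))
    (hG : ContinuousOn G (Icc ε ω))
    (hu0 : ∀ ξ ∈ Icc ε ω, 0 ≤ u ξ) (huV : ∀ ξ ∈ Icc ε ω, u ξ ≤ V)
    (hF0 : ∀ ξ ∈ Icc ε ω, 0 ≤ F ξ) (hG0 : ∀ ξ ∈ Icc ε ω, 0 ≤ G ξ)
    (hFa : ∀ ξ ∈ Icc ε ω, ∀ η ∈ Icc ε ω, F ξ ≤ a * F η)
    (hGa : ∀ ξ ∈ Icc ε ω, ∀ η ∈ Icc ε ω, G ξ ≤ a * G η)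
    (hN : ∀ ξ ∈ Icc ε ω, |F ξ - G ξ| ≤ N) :
    |(∫ ξ in ε..ω, u ξ * gapKernel T ξ (F ξ)) ^ 2 -
        (∫ ξ in ε..ω, u ξ * gapKernel T ξ (G ξ)) ^ 2| ≤
      V ^ 2 * Real.sqrt a * (∫ ξ in ε..ω, Real.tanh (ξ / (2 * T)) / ξ) ^ 2 * N := by
  have hpos : ∀ ξ ∈ Icc ε ω, 0 < ξ := fun ξ hξ => hε.trans_le hξ.1
  have hV : 0 ≤ V := (hu0 ε (left_mem_Icc.2 hω)).trans (huV ε (left_mem_Icc.2 hω))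
  set h : ℝ → ℝ := fun ξ => Real.tanh (ξ / (2 * T)) / ξ with h_def
  have hh0 : ∀ ξ ∈ Icc ε ω, 0 ≤ h ξ := fun ξ hξ =>
    div_nonneg (tanh_nonneg_of_nonneg (div_nonneg (hpos ξ hξ).le (by positivity))) (hpos ξ hξ).le
  have hhi : IntervalIntegrable h volume ε ω := by
    refine ContinuousOn.intervalIntegrable_of_Icc hω ?_
    exact (continuous_tanh_real.comp (continuous_id.div_const _)).continuousOn.div
      continuousOn_id fun ξ hξ => (hpos ξ hξ).ne'
  set J : ℝ := ∫ ξ in ε..ω, h ξ with J_def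
  have hJ : 0 ≤ J := intervalIntegral.integral_nonneg hω hh0
  have hint : ∀ E : ℝ → ℝ, ContinuousOn E (Icc ε ω) → (∀ ξ ∈ Icc ε ω, 0 ≤ E ξ) →
      IntervalIntegrable (fun ξ => u ξ * gapKernel T ξ (E ξ)) volume ε ω := by
    intro E hE hE0
    refine ContinuousOn.intervalIntegrable_of_Icc hω (hu.mul (ContinuousOn.mul ?_ ?_))
    · refine (hE.div ((continuousOn_id.pow 2).add hE) fun ξ hξ => ?_).sqrt
      have h1 := hpos ξ hξ
      have h2 := hE0 ξ hξ
      exact (by positivity : 0 < ξ ^ 2 + E ξ).ne'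
    · exact continuous_tanh_real.comp_continuousOn
        (((continuousOn_id.pow 2).add hE).sqrt.div_const _)
  have hbound : ∀ E : ℝ → ℝ, ContinuousOn E (Icc ε ω) → (∀ ξ ∈ Icc ε ω, 0 ≤ E ξ) →
      (∀ ξ ∈ Icc ε ω, ∀ η ∈ Icc ε ω, E ξ ≤ a * E η) → ∀ η ∈ Icc ε ω,
      ∫ ξ in ε..ω, u ξ * gapKernel T ξ (E ξ) ≤ V * (Real.sqrt a * Real.sqrt (E η)) * J := by
    intro E hE hE0 hEa η hη
    rw [J_def, ← intervalIntegral.integral_const_mul]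
    refine intervalIntegral.integral_mono_on hω (hint E hE hE0) (hhi.const_mul _)
      fun ξ hξ => ?_
    rw [← Real.sqrt_mul ha, mul_assoc]
    refine mul_le_mul (huV ξ hξ) ?_ (gapKernel_nonneg _ _ hT) hV
    exact (gapKernel_le hT (hpos ξ hξ) (hE0 ξ hξ)).trans
      (mul_le_mul_of_nonneg_right (Real.sqrt_le_sqrt (hEa ξ hξ η hη)) (hh0 ξ hξ))
  have hnonneg : ∀ E : ℝ → ℝ, 0 ≤ ∫ ξ in ε..ω, u ξ * gapKernel T ξ (E ξ) := fun E =>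
    intervalIntegral.integral_nonneg hω fun ξ hξ =>
      mul_nonneg (hu0 ξ hξ) (gapKernel_nonneg _ _ hT)
  have hSF := hbound F hF hF0 hFa
  have hSG := hbound G hG hG0 hGa
  have hSF0 := hnonneg F
  have hSG0 := hnonneg G
  rw [sq_sub_sq, ← intervalIntegral.integral_sub (hint F hF hF0) (hint G hG hG0)]
  set S := (∫ ξ in ε..ω, u ξ * gapKernel T ξ (F ξ)) +
    ∫ ξ in ε..ω, u ξ * gapKernel T ξ (G ξ) with S_def
  have hS0 : 0 ≤ S := add_nonneg hSF0 hSG0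
  rw [← intervalIntegral.integral_const_mul]
  have hpt : ∀ ξ ∈ Icc ε ω,
      ‖S * (u ξ * gapKernel T ξ (F ξ) - u ξ * gapKernel T ξ (G ξ))‖ ≤
        V ^ 2 * Real.sqrt a * J * N * h ξ := by
    intro ξ hξ
    have hS : S ≤ V * Real.sqrt a * J * (Real.sqrt (F ξ) + Real.sqrt (G ξ)) := by
      linarith [hSF ξ hξ, hSG ξ hξ]
    rw [← mul_sub, norm_mul, norm_mul, Real.norm_of_nonneg hS0,
      Real.norm_of_nonneg (hu0 ξ hξ), Real.norm_eq_abs]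
    have hh := hh0 ξ hξ
    calc S * (u ξ * |gapKernel T ξ (F ξ) - gapKernel T ξ (G ξ)|)
        ≤ (V * Real.sqrt a * J * (Real.sqrt (F ξ) + Real.sqrt (G ξ))) *
            (V * (|Real.sqrt (F ξ) - Real.sqrt (G ξ)| * h ξ)) := by
          refine mul_le_mul hS (mul_le_mul (huV ξ hξ) ?_ (abs_nonneg _) hV)
            (mul_nonneg (hu0 ξ hξ) (abs_nonneg _)) (by positivity)
          exact abs_gapKernel_sub_le hT (hpos ξ hξ) (hF0 ξ hξ) (hG0 ξ hξ)
      _ = V ^ 2 * Real.sqrt a * J * ((Real.sqrt (F ξ) + Real.sqrt (G ξ)) *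
            |Real.sqrt (F ξ) - Real.sqrt (G ξ)|) * h ξ := by ring
      _ = V ^ 2 * Real.sqrt a * J * |F ξ - G ξ| * h ξ := by
          rw [sqrt_add_sqrt_mul_abs_sqrt_sub_sqrt (hF0 ξ hξ) (hG0 ξ hξ)]
      _ ≤ V ^ 2 * Real.sqrt a * J * N * h ξ := by
          gcongr
          exact hN ξ hξ
  refine (intervalIntegral.norm_integral_le_of_norm_le hω
    (Eventually.of_forall fun ξ hξ => hpt ξ (Ioc_subset_Icc_self hξ))
    (hhi.const_mul _)).trans_eq ?_
  rw [intervalIntegral.integral_const_mul, ← J_def]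
  ring

lemma BCSContext.T₀_pos (C : BCSContext) : 0 < C.T₀ := C.htau₁pos.trans C.hT₀₁

lemma BCSContext.integral_tanh_div_le (C : BCSContext) {T : ℝ} (hT : C.tau₁ ≤ T) :
    ∫ ξ in C.eps..C.om, Real.tanh (ξ / (2 * T)) / ξ ≤ 1 / C.U₁ := by
  have hpos : ∀ ξ ∈ Icc C.eps C.om, 0 < ξ := fun ξ hξ => C.heps.trans_le hξ.1
  have hint : ∀ S : ℝ, IntervalIntegrable (fun ξ => Real.tanh (ξ / (2 * S)) / ξ)
      volume C.eps C.om := fun S =>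
    ContinuousOn.intervalIntegrable_of_Icc C.hepsom.le
      ((continuous_tanh_real.comp (continuous_id.div_const _)).continuousOn.div
        continuousOn_id fun ξ hξ => (hpos ξ hξ).ne')
  have hmono : ∫ ξ in C.eps..C.om, Real.tanh (ξ / (2 * T)) / ξ ≤
      ∫ ξ in C.eps..C.om, Real.tanh (ξ / (2 * C.tau₁)) / ξ := by
    refine intervalIntegral.integral_mono_on C.hepsom.le (hint T) (hint C.tau₁) fun ξ hξ => ?_
    have h0 := hpos ξ hξ
    have h1 := C.htau₁pos
    exact div_le_div_of_nonneg_right (tanh_monotone (by gcongr)) h0.le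
  refine hmono.trans_eq ?_
  rw [eq_div_iff C.hU₁pos.ne', mul_comm]
  exact C.htau₁.symm

section MemW

variable {C : BCSContext} {f g : ℝ → ℝ → ℝ} {T : ℝ}

lemma memW.nonneg (hf : memW C f) (hT : T ∈ Icc C.T₀ C.Tc) {x : ℝ} (hx : x ∈ C.Iset) :
    0 ≤ f T x :=
  (sq_nonneg _).trans (hf.2.1 T hT x hx).1

lemma memW.le_mul (hf : memW C f) (hT : T ∈ Icc C.T₀ C.Tc) {x y : ℝ} (hx : x ∈ C.Iset)
    (hy : y ∈ C.Iset) : f T x ≤ C.a * f T y := by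
  rcases hT.2.eq_or_lt with rfl | h
  · rw [hf.2.2.1 x hx, hf.2.2.1 y hy, mul_zero]
  · exact hf.2.2.2.1 T ⟨hT.1, h⟩ x hx y hy

lemma memW.continuousOn (hf : memW C f) (hT : T ∈ Icc C.T₀ C.Tc) :
    ContinuousOn (f T) (Icc C.eps C.om) :=
  hf.1.continuousOn.comp (f := fun x => (T, x)) (by fun_prop) fun _ hx => ⟨hT, hx⟩

lemma memW.abs_sub_le_sSup (hf : memW C f) (hg : memW C g) (hT : T ∈ Icc C.T₀ C.Tc) {x : ℝ}
    (hx : x ∈ C.Iset) :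
    |f T x - g T x| ≤
      sSup {y : ℝ | ∃ T' ∈ Icc C.T₀ C.Tc, ∃ x' ∈ C.Iset, y = |f T' x' - g T' x'|} := by
  refine le_csSup ?_ ⟨T, hT, x, hx, rfl⟩
  have hcomp : IsCompact C.Dset := isCompact_Icc.prod isCompact_Icc
  refine (hcomp.bddAbove_image (hf.1.continuousOn.sub hg.1.continuousOn).abs).mono ?_
  rintro _ ⟨T', hT', x', hx', rfl⟩
  exact ⟨(T', x'), ⟨hT', hx'⟩, rfl⟩

end MemW

theorem stmt_14 (C : BCSContext) (f g : ℝ → ℝ → ℝ) (hf : memW C f) (hg : memW C g) :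
    ∀ T ∈ Icc C.T₀ C.Tc, ∀ x ∈ C.Iset,
      |opA C f T x - opA C g T x| ≤
        (2 * (C.U₂ ^ 2 / C.U₁ ^ 2) * Real.sqrt C.a +
            C.U₂ ^ 2 * C.Δ₂ 0 ^ 2 / (C.U₁ * C.eps ^ 2)) *
          sSup {y : ℝ | ∃ T' ∈ Icc C.T₀ C.Tc, ∃ x' ∈ C.Iset, y = |f T' x' - g T' x'|} := by
  intro T hT x hx
  set N := sSup {y : ℝ | ∃ T' ∈ Icc C.T₀ C.Tc, ∃ x' ∈ C.Iset, y = |f T' x' - g T' x'|}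
  have hN0 : 0 ≤ N := (abs_nonneg _).trans (hf.abs_sub_le_sSup hg hT hx)
  have hTpos : 0 < T := C.T₀_pos.trans_le hT.1
  have hU₁ := C.hU₁pos
  have hu : ContinuousOn (C.U x) (Icc C.eps C.om) :=
    C.hUsmooth.continuousOn.comp (f := fun ξ => (x, ξ)) (by fun_prop) fun _ hξ => ⟨hx, hξ⟩
  have hmain := abs_sq_integral_gapKernel_sub_le (N := N) C.heps C.hepsom.le hTpos
    (C.ha ▸ sq_nonneg _ : 0 ≤ C.a) hu (hf.continuousOn hT) (hg.continuousOn hT)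
    (fun ξ hξ => hU₁.le.trans (C.hUlb x hx ξ hξ)) (C.hUub x hx)
    (fun _ h => hf.nonneg hT h) (fun _ h => hg.nonneg hT h)
    (fun _ h _ h' => hf.le_mul hT h h') (fun _ h _ h' => hg.le_mul hT h h')
    (fun _ h => hf.abs_sub_le_sSup hg hT h)
  have hJ := C.integral_tanh_div_le (C.hT₀₁.le.trans hT.1)
  have hJ0 : 0 ≤ ∫ ξ in C.eps..C.om, Real.tanh (ξ / (2 * T)) / ξ :=
    intervalIntegral.integral_nonneg C.hepsom.le fun ξ hξ =>
      have h0 : 0 < ξ := C.heps.trans_le hξ.1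
      div_nonneg (tanh_nonneg_of_nonneg (by positivity)) h0.le
  simp only [opA, mul_assoc (C.U x _)]
  refine hmain.trans (mul_le_mul_of_nonneg_right ?_ hN0)
  have h2 : 0 ≤ C.U₂ ^ 2 * C.Δ₂ 0 ^ 2 / (C.U₁ * C.eps ^ 2) := by positivity
  have h3 : 0 ≤ C.U₂ ^ 2 / C.U₁ ^ 2 * Real.sqrt C.a := by positivity
  calc C.U₂ ^ 2 * Real.sqrt C.a * (∫ ξ in C.eps..C.om, Real.tanh (ξ / (2 * T)) / ξ) ^ 2
      ≤ C.U₂ ^ 2 * Real.sqrt C.a * (1 / C.U₁) ^ 2 := by gcongr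
    _ = C.U₂ ^ 2 / C.U₁ ^ 2 * Real.sqrt C.a := by ring
    _ ≤ _ := by linarith

end
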